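/- Triangle detection lemma, homology version (over 𝔽₂): Under the hypotheses of the triangle detection lemma (chain complexes C_i with maps f_i, g_i, h_i satisfying d² = 0, df + fd = 0, dg + ff + gd = 0, dh + fg + gf + hd ≃ id), writing H_i for the homology of (C_i, d_i), the induced maps (f_i)_* fit into a long exact sequence: ... → H_1 → H_0 → H_{-1} → H_1 → ... (an exact triangle among H_{-1}, H_0, H_1). -/

import Mathlib

section HomologyDefs

variable {R : Type*} [CommRing R] {V W : Type*}
  [AddCommGroup V] [Module R V] [AddCommGroup W] [Module R W]

/-- The boundaries, viewed as a submodule of the cycles. -/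
abbrev bdries (d : V →ₗ[R] V) : Submodule R (LinearMap.ker d) :=
  (LinearMap.range d).comap (LinearMap.ker d).subtype

/-- The homology of the (ungraded) complex `(V, d)`. -/
abbrev Hmod (d : V →ₗ[R] V) := LinearMap.ker d ⧸ bdries d

/-- The map induced on homology by a chain map `f` (anticommuting form, as is
appropriate over 𝔽₂ where `d f + f d = 0` is the chain-map condition). -/
noncomputable def Hmap (dV : V →ₗ[R] V) (dW : W →ₗ[R] W) (f : V →ₗ[R] W)
    (hf : dW ∘ₗ f + f ∘ₗ dV = 0) : Hmod dV →ₗ[R] Hmod dW := by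
  refine Submodule.mapQ (bdries dV) (bdries dW)
    (f.restrict (p := LinearMap.ker dV) (q := LinearMap.ker dW) ?_) ?_
  · intro x hx
    have h := LinearMap.congr_fun hf x
    simp only [LinearMap.add_apply, LinearMap.comp_apply, LinearMap.zero_apply] at h
    rw [LinearMap.mem_ker] at hx ⊢
    rw [hx, map_zero, add_zero] at h
    exact h
  · rintro ⟨x, hx⟩ hmem
    simp only [Submodule.mem_comap, Submodule.subtype_apply, LinearMap.mem_range,
      LinearMap.restrict_apply] at hmem ⊢
    obtain ⟨y, hy⟩ := hmem
    refine ⟨-(f y), ?_⟩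
    have h := LinearMap.congr_fun hf y
    simp only [LinearMap.add_apply, LinearMap.comp_apply, LinearMap.zero_apply] at h
    rw [map_neg, ← hy]
    exact neg_eq_of_add_eq_zero_right h

end HomologyDefs

theorem exact_aux {A B C : Type*}
    [AddCommGroup A] [Module (ZMod 2) A]
    [AddCommGroup B] [Module (ZMod 2) B]
    [AddCommGroup C] [Module (ZMod 2) C]
    (dA : A →ₗ[ZMod 2] A) (dB : B →ₗ[ZMod 2] B) (dC : C →ₗ[ZMod 2] C)
    (a : A →ₗ[ZMod 2] B) (b : B →ₗ[ZMod 2] C) (c : C →ₗ[ZMod 2] A)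
    (ga : A →ₗ[ZMod 2] C) (gb : B →ₗ[ZMod 2] A) (gc : C →ₗ[ZMod 2] B)
    (h q : B →ₗ[ZMod 2] B)
    (ha : dB ∘ₗ a + a ∘ₗ dA = 0)
    (hb : dC ∘ₗ b + b ∘ₗ dB = 0)
    (hc : dA ∘ₗ c + c ∘ₗ dC = 0)
    (hga : dC ∘ₗ ga + b ∘ₗ a + ga ∘ₗ dA = 0)
    (hgb : dA ∘ₗ gb + c ∘ₗ b + gb ∘ₗ dB = 0)
    (hgc : dB ∘ₗ gc + a ∘ₗ c + gc ∘ₗ dC = 0)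
    (hh : dB ∘ₗ h + a ∘ₗ gb + gc ∘ₗ b + h ∘ₗ dB = q)
    (hq : ∃ K : B →ₗ[ZMod 2] B, q + LinearMap.id = dB ∘ₗ K + K ∘ₗ dB) :
    Function.Exact (Hmap dA dB a ha) (Hmap dB dC b hb) := by
  obtain ⟨K, hK⟩ := hq
  intro t
  obtain ⟨⟨x, hx⟩, rfl⟩ := Submodule.Quotient.mk_surjective _ t
  have hx' : dB x = 0 := hx
  constructor
  · intro ht
    have ht' := (Submodule.Quotient.mk_eq_zero _).1 ht
    obtain ⟨y, hy⟩ : ∃ y, dC y = b x := ht'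
    have e1 := LinearMap.congr_fun hh x
    have e2 := LinearMap.congr_fun hK x
    have e3 := LinearMap.congr_fun hgc y
    have e4 := LinearMap.congr_fun hgb x
    have e5 := LinearMap.congr_fun hc y
    simp only [LinearMap.add_apply, LinearMap.comp_apply, LinearMap.zero_apply,
      LinearMap.id_apply, hx', map_zero, add_zero, hy] at e1 e2 e3 e4 e5
    have hz : dA (gb x + c y) = 0 := by
      rw [map_add]
      have := ZModModule.add_self (c (b x))
      grind
    refine ⟨Submodule.Quotient.mk ⟨gb x + c y, hz⟩, ?_⟩
    refine (Submodule.Quotient.eq _).2 ?_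
    change ∃ w, dB w = a (gb x + c y) - x
    refine ⟨h x + gc y + K x, ?_⟩
    simp only [map_add]
    rw [ZModModule.sub_eq_add]
    have i1 := ZModModule.add_self (dB (h x))
    have i6 := ZModModule.add_self (a (c y))
    linear_combination (norm := module) e3 - e2 - e1 + i1 - i6
  · rintro ⟨s, hs⟩
    rw [← hs]
    obtain ⟨⟨z, hz⟩, rfl⟩ := Submodule.Quotient.mk_surjective _ s
    have hz' : dA z = 0 := hz
    refine (Submodule.Quotient.mk_eq_zero _).2 ?_
    change ∃ w, dC w = b (a z)
    have e := LinearMap.congr_fun hga z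
    simp only [LinearMap.add_apply, LinearMap.comp_apply, LinearMap.zero_apply,
      hz', map_zero, add_zero] at e
    refine ⟨ga z, ?_⟩
    rw [eq_neg_of_add_eq_zero_left e, ZModModule.neg_eq_self]

/-- Triangle detection lemma over 𝔽₂, homology version: with the 3-periodic convention
unrolled into complexes `C₀, C₁, C₂`, the induced maps `(fᵢ)_*` form an exact triangle
`H₁ → H₀ → H₂(= H_{-1}) → H₁`. -/
theorem triangle_detection_homology
    (C0 C1 C2 : Type*)
    [AddCommGroup C0] [Module (ZMod 2) C0]
    [AddCommGroup C1] [Module (ZMod 2) C1]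
    [AddCommGroup C2] [Module (ZMod 2) C2]
    (d0 : C0 →ₗ[ZMod 2] C0) (d1 : C1 →ₗ[ZMod 2] C1) (d2 : C2 →ₗ[ZMod 2] C2)
    (f0 : C0 →ₗ[ZMod 2] C2) (f1 : C1 →ₗ[ZMod 2] C0) (f2 : C2 →ₗ[ZMod 2] C1)
    (g0 : C0 →ₗ[ZMod 2] C1) (g1 : C1 →ₗ[ZMod 2] C2) (g2 : C2 →ₗ[ZMod 2] C0)
    (h0 : C0 →ₗ[ZMod 2] C0) (h1 : C1 →ₗ[ZMod 2] C1) (h2 : C2 →ₗ[ZMod 2] C2)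
    (q0 : C0 →ₗ[ZMod 2] C0) (q1 : C1 →ₗ[ZMod 2] C1) (q2 : C2 →ₗ[ZMod 2] C2)
    (hd0 : d0 ∘ₗ d0 = 0) (hd1 : d1 ∘ₗ d1 = 0) (hd2 : d2 ∘ₗ d2 = 0)
    (hf0 : d2 ∘ₗ f0 + f0 ∘ₗ d0 = 0)
    (hf1 : d0 ∘ₗ f1 + f1 ∘ₗ d1 = 0)
    (hf2 : d1 ∘ₗ f2 + f2 ∘ₗ d2 = 0)
    (hg0 : d1 ∘ₗ g0 + f2 ∘ₗ f0 + g0 ∘ₗ d0 = 0)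
    (hg1 : d2 ∘ₗ g1 + f0 ∘ₗ f1 + g1 ∘ₗ d1 = 0)
    (hg2 : d0 ∘ₗ g2 + f1 ∘ₗ f2 + g2 ∘ₗ d2 = 0)
    (hh0 : d0 ∘ₗ h0 + f1 ∘ₗ g0 + g2 ∘ₗ f0 + h0 ∘ₗ d0 = q0)
    (hh1 : d1 ∘ₗ h1 + f2 ∘ₗ g1 + g0 ∘ₗ f1 + h1 ∘ₗ d1 = q1)
    (hh2 : d2 ∘ₗ h2 + f0 ∘ₗ g2 + g1 ∘ₗ f2 + h2 ∘ₗ d2 = q2)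
    (hq0 : ∃ K : C0 →ₗ[ZMod 2] C0, q0 + LinearMap.id = d0 ∘ₗ K + K ∘ₗ d0)
    (hq1 : ∃ K : C1 →ₗ[ZMod 2] C1, q1 + LinearMap.id = d1 ∘ₗ K + K ∘ₗ d1)
    (hq2 : ∃ K : C2 →ₗ[ZMod 2] C2, q2 + LinearMap.id = d2 ∘ₗ K + K ∘ₗ d2) :
    Function.Exact (Hmap d1 d0 f1 hf1) (Hmap d0 d2 f0 hf0) ∧
    Function.Exact (Hmap d0 d2 f0 hf0) (Hmap d2 d1 f2 hf2) ∧
    Function.Exact (Hmap d2 d1 f2 hf2) (Hmap d1 d0 f1 hf1) := by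
  exact ⟨exact_aux d1 d0 d2 f1 f0 f2 g1 g0 g2 h0 q0 hf1 hf0 hf2 hg1 hg0 hg2 hh0 hq0,
    exact_aux d0 d2 d1 f0 f2 f1 g0 g2 g1 h2 q2 hf0 hf2 hf1 hg0 hg2 hg1 hh2 hq2,
    exact_aux d2 d1 d0 f2 f1 f0 g2 g1 g0 h1 q1 hf2 hf1 hf0 hg2 hg1 hg0 hh1 hq1⟩
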